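/- Let G be a connected subcubic graph (every vertex has degree at most 3) with infinite motion (every non-identity automorphism of G moves infinitely many vertices). Then G admits a proper vertex colouring with 4 colours that is preserved only by the identity automorphism; that is, χ_D(G) ≤ 4. -/

import Mathlib

open SimpleGraph

/-- A vertex colouring is proper if adjacent vertices receive distinct colours. -/
def IsProperVertexColoring {V α : Type*} (G : SimpleGraph V) (c : V → α) : Prop :=
  ∀ u v, G.Adj u v → c u ≠ c v

/-- A vertex colouring is distinguishing if the identity is the only automorphism
preserving it. -/
def IsDistinguishingVertexColoring {V α : Type*} (G : SimpleGraph V) (c : V → α) : Prop :=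
  ∀ φ : G ≃g G, (∀ v, c (φ v) = c v) → ∀ v, φ v = v

/-- An edge colouring is proper if distinct edges sharing a vertex receive distinct
colours. -/
def IsProperEdgeColoring {V α : Type*} (G : SimpleGraph V) (c : Sym2 V → α) : Prop :=
  ∀ u v w, G.Adj u v → G.Adj u w → v ≠ w → c s(u, v) ≠ c s(u, w)

/-- An edge colouring is distinguishing if the identity is the only automorphism
preserving it. -/
def IsDistinguishingEdgeColoring {V α : Type*} (G : SimpleGraph V) (c : Sym2 V → α) : Prop :=
  ∀ φ : G ≃g G, (∀ u v, G.Adj u v → c s(φ u, φ v) = c s(u, v)) → ∀ v, φ v = v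

/-- A total colouring (of vertices and edges) is proper if adjacent vertices get distinct
colours, incident edges get distinct colours, and every vertex gets a colour distinct
from every edge incident with it. -/
def IsProperTotalColoring {V α : Type*} (G : SimpleGraph V) (cv : V → α) (ce : Sym2 V → α) :
    Prop :=
  (∀ u v, G.Adj u v → cv u ≠ cv v) ∧
  (∀ u v w, G.Adj u v → G.Adj u w → v ≠ w → ce s(u, v) ≠ ce s(u, w)) ∧
  (∀ u v, G.Adj u v → cv u ≠ ce s(u, v))

/-- A total colouring is distinguishing if the identity is the only automorphism
preserving it. -/
def IsDistinguishingTotalColoring {V α : Type*} (G : SimpleGraph V) (cv : V → α)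
    (ce : Sym2 V → α) : Prop :=
  ∀ φ : G ≃g G,
    ((∀ v, cv (φ v) = cv v) ∧ (∀ u v, G.Adj u v → ce s(φ u, φ v) = ce s(u, v))) →
    ∀ v, φ v = v

/-- Greedy colouring along a rank function, starting from a prescribed colouring of `B` and
using the last colour whenever possible. -/
theorem exists_greedy_coloring {V : Type*} {k : ℕ} (f : V → ℕ) (H : V → V → Prop)
    (hsymm : ∀ u v, H u v → H v u) (hirr : ∀ v, ¬ H v v) (B : Set V) (c₀ : V → Fin (k + 1))
    (hcard : ∀ v, v ∉ B → ∃ t : Finset V, t.card ≤ k ∧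
      ∀ u, H v u → (u ∈ B ∨ f u ≤ f v) → u ∈ t) :
    ∃ c : V → Fin (k + 1), (∀ v ∈ B, c v = c₀ v) ∧
      (∀ u v, H u v → v ∉ B → c u ≠ c v) ∧
      (∀ v, v ∉ B → c v = Fin.last k ∨
        ∃ u, H v u ∧ (u ∈ B ∨ f u ≤ f v) ∧ c u = Fin.last k) := by
  classical
  let R : V → V → Prop := fun u v => f u < f v ∨ (f u = f v ∧ WellOrderingRel u v)
  have hR : WellFounded R := by
    have h := (Prod.lex (⟨_, wellFounded_lt⟩ : WellFoundedRelation ℕ)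
      ⟨_, (WellOrderingRel.isWellOrder (α := V)).wf⟩).wf
    refine Subrelation.wf (r := InvImage (Prod.Lex (· < ·) WellOrderingRel)
      (fun v => (f v, v))) ?_ (InvImage.wf _ h)
    rintro u v (h | ⟨h, h'⟩)
    · exact Prod.Lex.left _ _ h
    · change Prod.Lex _ _ (f u, u) (f v, v)
      rw [h]
      exact Prod.Lex.right _ h'
  have hRle : ∀ u v, R u v → f u ≤ f v := by
    rintro u v (h | ⟨h, -⟩)
    · exact h.le
    · exact h.le
  have hRtot : ∀ u v, u ≠ v → R u v ∨ R v u := by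
    intro u v huv
    rcases lt_trichotomy (f u) (f v) with h | h | h
    · exact Or.inl (Or.inl h)
    · rcases trichotomous_of WellOrderingRel u v with h' | h' | h'
      · exact Or.inl (Or.inr ⟨h, h'⟩)
      · exact absurd h' huv
      · exact Or.inr (Or.inr ⟨h.symm, h'⟩)
    · exact Or.inr (Or.inl h)
  let used : (v : V) → ((u : V) → R u v → Fin (k + 1)) → Set (Fin (k + 1)) := fun v ih =>
    {a | ∃ u, H v u ∧ ((u ∈ B ∧ c₀ u = a) ∨ (u ∉ B ∧ ∃ h : R u v, ih u h = a))}
  let pick : Set (Fin (k + 1)) → Fin (k + 1) := fun S =>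
    if Fin.last k ∉ S then Fin.last k else if h : ∃ a, a ∉ S then h.choose else 0
  let F : (v : V) → ((u : V) → R u v → Fin (k + 1)) → Fin (k + 1) := fun v ih =>
    if v ∈ B then c₀ v else pick (used v ih)
  let c : V → Fin (k + 1) := hR.fix F
  have hc : ∀ v, c v = F v (fun u _ => c u) := fun v => hR.fix_eq F v
  have hB : ∀ v ∈ B, c v = c₀ v := by
    intro v hv
    rw [hc]
    simp [F, hv]
  have hused : ∀ v, used v (fun u _ => c u) = {a | ∃ u, H v u ∧ (u ∈ B ∨ R u v) ∧ c u = a} := by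
    intro v
    ext a
    constructor
    · rintro ⟨u, hu, ⟨h1, h2⟩ | ⟨-, h2, h3⟩⟩
      · exact ⟨u, hu, Or.inl h1, by rw [hB u h1, h2]⟩
      · exact ⟨u, hu, Or.inr h2, h3⟩
    · rintro ⟨u, hu, h1, h2⟩
      by_cases hb : u ∈ B
      · exact ⟨u, hu, Or.inl ⟨hb, by rw [← hB u hb, h2]⟩⟩
      · exact ⟨u, hu, Or.inr ⟨hb, h1.resolve_left hb, h2⟩⟩
  have hcv : ∀ v, v ∉ B → c v = pick {a | ∃ u, H v u ∧ (u ∈ B ∨ R u v) ∧ c u = a} := by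
    intro v hv
    rw [hc, ← hused]
    simp [F, hv]
  have hex : ∀ v, v ∉ B → ∃ a, a ∉ {a | ∃ u, H v u ∧ (u ∈ B ∨ R u v) ∧ c u = a} := by
    intro v hv
    obtain ⟨t, ht, htu⟩ := hcard v hv
    have : (t.image c).card < (Finset.univ : Finset (Fin (k + 1))).card := by
      rw [Finset.card_univ, Fintype.card_fin]
      exact Nat.lt_succ_of_le (Finset.card_image_le.trans ht)
    obtain ⟨a, -, ha⟩ := Finset.exists_mem_notMem_of_card_lt_card this
    refine ⟨a, ?_⟩
    rintro ⟨u, hu, h1, rfl⟩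
    exact ha (Finset.mem_image_of_mem c (htu u hu (h1.imp_right (hRle u v))))
  have hgood : ∀ v, v ∉ B → c v ∉ {a | ∃ u, H v u ∧ (u ∈ B ∨ R u v) ∧ c u = a} := by
    intro v hv
    have h := hex v hv
    rw [hcv v hv]
    generalize {a | ∃ u, H v u ∧ (u ∈ B ∨ R u v) ∧ c u = a} = S at h
    by_cases hl : Fin.last k ∈ S
    · simp only [pick, hl, not_true_eq_false, if_false, dif_pos h]
      exact h.choose_spec
    · simp [pick, hl]
  refine ⟨c, hB, ?_, ?_⟩
  · intro u v huv hv heq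
    by_cases hu : u ∈ B
    · exact hgood v hv ⟨u, hsymm _ _ huv, Or.inl hu, heq⟩
    · rcases hRtot u v (fun h => hirr v (h ▸ huv)) with h | h
      · exact hgood v hv ⟨u, hsymm _ _ huv, Or.inr h, heq⟩
      · exact hgood u hu ⟨v, huv, Or.inr h, heq.symm⟩
  · intro v hv
    by_cases hl : Fin.last k ∈ {a | ∃ u, H v u ∧ (u ∈ B ∨ R u v) ∧ c u = a}
    · obtain ⟨u, hu, h1, h2⟩ := hl
      exact Or.inr ⟨u, hu, h1.imp_right (hRle u v), h2⟩
    · left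
      rw [hcv v hv]
      simp only [pick, hl, not_false_eq_true, if_true]

/-- A level function: a locally Lipschitz function to `ℕ` with finite sublevel sets that can be
decreased by a step along an edge at every vertex of positive level. -/
structure IsLevelFunction {V : Type*} (G : SimpleGraph V) (l : V → ℕ) : Prop where
  adj_le : ∀ u v, G.Adj u v → l u ≤ l v + 1
  exists_lower : ∀ v, 0 < l v → ∃ u, G.Adj v u ∧ l u + 1 = l v
  finite_le : ∀ n, {v | l v ≤ n}.Finite

/-- The vertex `v` has a neighbour on the next level. -/
def HasUpper {V : Type*} (G : SimpleGraph V) (l : V → ℕ) (v : V) : Prop :=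
  ∃ w, G.Adj v w ∧ l w = l v + 1

/-- Two distinct vertices of the same level are siblings if they have the same neighbours on the
previous level and both have neighbours on the next level. -/
def Sibling {V : Type*} (G : SimpleGraph V) (l : V → ℕ) (u v : V) : Prop :=
  u ≠ v ∧ l u = l v ∧ (∀ x, l x + 1 = l u → (G.Adj u x ↔ G.Adj v x)) ∧
    HasUpper G l u ∧ HasUpper G l v

theorem Sibling.symm {V : Type*} {G : SimpleGraph V} {l : V → ℕ} {u v : V}
    (h : Sibling G l u v) : Sibling G l v u :=
  ⟨h.1.symm, h.2.1.symm, fun x hx => (h.2.2.1 x (hx.trans h.2.1.symm)).symm,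
    h.2.2.2.2, h.2.2.2.1⟩

/-- In a subcubic graph, a vertex does not have four distinct neighbours. -/
theorem no_four_neighbors {V : Type*} {G : SimpleGraph V}
    (hdeg : ∀ v, (G.neighborSet v).Finite ∧ (G.neighborSet v).ncard ≤ 3) {v a b c d : V}
    (ha : G.Adj v a) (hb : G.Adj v b) (hc : G.Adj v c) (hd : G.Adj v d)
    (hab : a ≠ b) (hac : a ≠ c) (had : a ≠ d) (hbc : b ≠ c) (hbd : b ≠ d) (hcd : c ≠ d) :
    False := by
  classical
  have h4 : (({a, b, c, d} : Finset V) : Set V).ncard = 4 := by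
    rw [Set.ncard_coe_finset]
    simp [*]
  have hsub : (({a, b, c, d} : Finset V) : Set V) ⊆ G.neighborSet v := by
    intro x hx
    simp only [Finset.coe_insert, Finset.coe_singleton, Set.mem_insert_iff,
      Set.mem_singleton_iff] at hx
    rcases hx with rfl | rfl | rfl | rfl <;> assumption
  have := Set.ncard_le_ncard hsub (hdeg v).1
  have := (hdeg v).2
  omega

/-- In a subcubic graph, a vertex of level at least two has at most one sibling. -/
theorem Sibling.unique {V : Type*} {G : SimpleGraph V} {l : V → ℕ} (hl : IsLevelFunction G l)
    (hdeg : ∀ v, (G.neighborSet v).Finite ∧ (G.neighborSet v).ncard ≤ 3) {v u w : V}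
    (hv : 2 ≤ l v) (hu : Sibling G l v u) (hw : Sibling G l v w) : u = w := by
  by_contra hne
  obtain ⟨x, hx, hlx⟩ := hl.exists_lower v (by omega)
  obtain ⟨y, hy, hly⟩ := hl.exists_lower x (by omega)
  have hu1 := (hu.2.2.1 x hlx).1 hx
  have hw1 := (hw.2.2.1 x hlx).1 hx
  have h1 := hu.2.1
  have h2 := hw.2.1
  refine no_four_neighbors hdeg hx.symm hu1.symm hw1.symm hy hu.1 hw.1 ?_ hne ?_ ?_ <;>
  · rintro rfl
    omega

/-- An automorphism preserving the levels preserves having a neighbour on the next level. -/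
theorem HasUpper.map {V : Type*} {G : SimpleGraph V} {l : V → ℕ} {v : V} (φ : G ≃g G)
    (hφ : ∀ v, l (φ v) = l v) (h : HasUpper G l v) : HasUpper G l (φ v) := by
  obtain ⟨w, hw, hlw⟩ := h
  exact ⟨φ w, φ.map_adj_iff.2 hw, by rw [hφ, hφ, hlw]⟩

/-- If two level-preserving automorphisms agree on the lower neighbours of `v`, then they send `v`
to equal or sibling vertices. -/
theorem eq_or_sibling_of_agree {V : Type*} {G : SimpleGraph V} {l : V → ℕ} {v : V}
    (φ ψ : G ≃g G) (hφ : ∀ v, l (φ v) = l v) (hψ : ∀ v, l (ψ v) = l v) (hv : HasUpper G l v)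
    (h : ∀ x, G.Adj v x → l x + 1 = l v → ψ x = φ x) :
    ψ v = φ v ∨ Sibling G l (φ v) (ψ v) := by
  by_cases heq : ψ v = φ v
  · exact Or.inl heq
  refine Or.inr ⟨fun h => heq h.symm, by rw [hφ, hψ], ?_, hv.map φ hφ, hv.map ψ hψ⟩
  intro x hx
  rw [hφ] at hx
  constructor
  · intro hadj
    obtain ⟨y, rfl⟩ := φ.surjective x
    rw [hφ] at hx
    have hy : G.Adj v y := φ.map_adj_iff.1 hadj
    rw [← h y hy hx]
    exact ψ.map_adj_iff.2 hy
  · intro hadj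
    obtain ⟨y, rfl⟩ := ψ.surjective x
    rw [hψ] at hx
    have hy : G.Adj v y := ψ.map_adj_iff.1 hadj
    rw [h y hy hx]
    exact φ.map_adj_iff.2 hy

/-- In a graph with infinite motion, a level-preserving automorphism fixing all vertices of level
`k` with neighbours on the next level fixes all vertices of level at most `k`. -/
theorem fixes_of_fixes_level {V : Type*} {G : SimpleGraph V} {l : V → ℕ}
    (hl : IsLevelFunction G l)
    (hmotion : ∀ φ : G ≃g G, (∃ v, φ v ≠ v) → {v | φ v ≠ v}.Infinite)
    (φ : G ≃g G) (hφ : ∀ v, l (φ v) = l v) (k : ℕ)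
    (h : ∀ v, l v = k → HasUpper G l v → φ v = v) : ∀ v, l v ≤ k → φ v = v := by
  classical
  have hφs : ∀ v, l (φ.symm v) = l v := fun v => by
    conv_rhs => rw [← φ.apply_symm_apply v, hφ]
  have key : ∀ a b, l a ≤ k → ¬ l b ≤ k → (G.Adj (φ a) b ↔ G.Adj a b) := by
    intro a b ha hb
    constructor
    · intro hab
      have h1 := hl.adj_le _ _ hab.symm
      rw [hφ] at h1
      have h2 : HasUpper G l a := by
        have h3 : HasUpper G l (φ a) := ⟨b, hab, by rw [hφ]; omega⟩
        simpa using h3.map φ.symm hφs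
      rwa [h a (by omega) h2] at hab
    · intro hab
      have h1 := hl.adj_le _ _ hab.symm
      rwa [h a (by omega) ⟨b, hab, by omega⟩]
  let χ : G ≃g G :=
    { toFun := fun v => if l v ≤ k then φ v else v
      invFun := fun v => if l v ≤ k then φ.symm v else v
      left_inv := by
        intro v
        by_cases hv : l v ≤ k <;> simp [hv, hφ]
      right_inv := by
        intro v
        by_cases hv : l v ≤ k <;> simp [hv, hφs]
      map_rel_iff' := by
        intro a b
        simp only [Equiv.coe_fn_mk]
        by_cases ha : l a ≤ k <;> by_cases hb : l b ≤ k
        · simp only [ha, hb, if_true]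
          exact φ.map_adj_iff
        · simp only [ha, hb, if_true, if_false]
          exact key a b ha hb
        · simp only [ha, hb, if_true, if_false]
          rw [G.adj_comm, key b a hb ha, G.adj_comm]
        · simp only [ha, hb, if_false] }
  have hχ : ∀ v, χ v = if l v ≤ k then φ v else v := fun v => rfl
  by_contra hcon
  push Not at hcon
  obtain ⟨v, hv, hne⟩ := hcon
  refine hmotion χ ⟨v, by rw [hχ, if_pos hv]; exact hne⟩ ((hl.finite_le k).subset ?_)
  intro w hw
  by_contra hwk
  have hwk' : ¬ l w ≤ k := hwk
  exact hw (by rw [hχ, if_neg hwk'])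

/-- Two automorphisms preserving the levels and a sibling-distinguishing colouring up to level `n`
agree up to level `n` as soon as they agree up to level `m`. -/
theorem agree_of_agree {V : Type*} {G : SimpleGraph V} {l : V → ℕ}
    (hl : IsLevelFunction G l)
    (hmotion : ∀ φ : G ≃g G, (∃ v, φ v ≠ v) → {v | φ v ≠ v}.Infinite)
    {c : V → Fin 4} {m n : ℕ}
    (hc : ∀ u v, m < l v → Sibling G l u v → c u ≠ c v)
    (φ ψ : G ≃g G) (hφ : ∀ v, l (φ v) = l v) (hψ : ∀ v, l (ψ v) = l v)
    (hφc : ∀ v, l v ≤ n → c (φ v) = c v) (hψc : ∀ v, l v ≤ n → c (ψ v) = c v)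
    (h : ∀ v, l v ≤ m → ψ v = φ v) : ∀ v, l v ≤ n → ψ v = φ v := by
  have main : ∀ k, k ≤ n → ∀ v, l v ≤ k → ψ v = φ v := by
    intro k
    induction k with
    | zero => exact fun _ v hv => h v (by omega)
    | succ k ih =>
      intro hk
      by_cases hkm : k + 1 ≤ m
      · exact fun v hv => h v (by omega)
      have hφs : ∀ v, l (φ.symm v) = l v := fun v => by
        conv_rhs => rw [← φ.apply_symm_apply v, hφ]
      have hfix := fixes_of_fixes_level hl hmotion (ψ.trans φ.symm)
        (fun v => by simp [hφs, hψ]) (k + 1) ?_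
      · intro v hv
        have := hfix v hv
        simp only [RelIso.trans_apply] at this
        rw [← this, RelIso.apply_symm_apply, this]
      · intro v hv hup
        simp only [RelIso.trans_apply]
        rw [RelIso.symm_apply_eq]
        refine (eq_or_sibling_of_agree φ ψ hφ hψ hup
          (fun x _ hx => ih (by omega) x (by omega))).resolve_right ?_
        intro hs
        refine hc _ _ ?_ hs ?_
        · rw [hψ]; omega
        · rw [hφc v (by omega), hψc v (by omega)]
  exact main n le_rfl

/-- Recolouring of all levels from `j` on such that siblings get distinct colours, the colour of
`p` does not occur in `T`, and the last colour is used wherever possible outside `T`. -/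
theorem exists_recoloring {V : Type*} {G : SimpleGraph V} {l : V → ℕ}
    (hl : IsLevelFunction G l)
    (hdeg : ∀ v, (G.neighborSet v).Finite ∧ (G.neighborSet v).ncard ≤ 3)
    (c₀ : V → Fin 4) (hc₀ : IsProperVertexColoring G c₀) (j : ℕ) (hj : 2 ≤ j) (p : V) (T : Set V)
    (hT : ∀ t ∈ T, l t = l p ∧ j ≤ l t ∧ HasUpper G l t ∧ t ≠ p)
    (hT' : ∀ t ∈ T, (∀ u, (u ∈ T ∨ Sibling G l t u) → u = t) ∨
      ∃ x s, (∀ y, G.Adj t y → l y + 1 = l t → y = x) ∧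
        ∀ u, (u ∈ T ∨ Sibling G l t u) → u = t ∨ u = s) :
    ∃ c : V → Fin 4, (∀ v, l v < j → c v = c₀ v) ∧ IsProperVertexColoring G c ∧
      (∀ u v, j ≤ l u → Sibling G l u v → c u ≠ c v) ∧ (∀ t ∈ T, c t ≠ c p) ∧
      ∀ v, j ≤ l v → (∃ w, G.dist v w ≤ 2 ∧ l w ≤ l v ∧ c w = 3) ∨ v ∈ T := by
  classical
  let f : V → ℕ := fun v => 3 * l v + if v = p then 0 else if v ∈ T then 1 else 2
  let H : V → V → Prop := fun u v =>
    G.Adj u v ∨ Sibling G l u v ∨ (u = p ∧ v ∈ T) ∨ (v = p ∧ u ∈ T)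
  have hfp : f p = 3 * l p := by simp [f]
  have hfT : ∀ t ∈ T, f t = 3 * l t + 1 := fun t ht => by simp [f, ht, (hT t ht).2.2.2]
  have hfo : ∀ v, v ≠ p → v ∉ T → f v = 3 * l v + 2 := fun v h1 h2 => by simp [f, h1, h2]
  have hf : ∀ v, 3 * l v ≤ f v ∧ f v ≤ 3 * l v + 2 := by
    intro v
    by_cases h1 : v = p
    · subst h1; omega
    by_cases h2 : v ∈ T
    · have := hfT v h2; omega
    · have := hfo v h1 h2; omega
  have hN : ∀ v, ∃ t : Finset V, t.card ≤ 3 ∧ ∀ u, u ∈ t ↔ G.Adj v u := by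
    intro v
    refine ⟨(hdeg v).1.toFinset, ?_, fun u => by simp⟩
    rw [← Set.ncard_eq_toFinset_card _ (hdeg v).1]
    exact (hdeg v).2
  have hNup : ∀ v, HasUpper G l v → ∃ t : Finset V, t.card ≤ 2 ∧
      ∀ u, G.Adj v u → l u ≤ l v → u ∈ t := by
    rintro v ⟨w, hw, hlw⟩
    obtain ⟨t, ht, htu⟩ := hN v
    refine ⟨t.erase w, ?_, ?_⟩
    · rw [Finset.card_erase_of_mem ((htu w).2 hw)]
      omega
    · intro u hu hlu
      refine Finset.mem_erase.2 ⟨?_, (htu u).2 hu⟩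
      rintro rfl
      omega
  have hle : ∀ u v, j ≤ l v → (l u < j ∨ f u ≤ f v) → l u ≤ l v := by
    rintro u v hv (h | h)
    · omega
    · have := hf u; have := hf v; omega
  obtain ⟨c, hcB, hcH, hc3⟩ := exists_greedy_coloring (k := 3) f H
    (by
      rintro u v (h | h | h | h)
      · exact Or.inl h.symm
      · exact Or.inr (Or.inl h.symm)
      · exact Or.inr (Or.inr (Or.inr h))
      · exact Or.inr (Or.inr (Or.inl h)))
    (by
      rintro v (h | h | ⟨rfl, h⟩ | ⟨rfl, h⟩)
      · exact h.ne rfl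
      · exact h.1 rfl
      · exact (hT _ h).2.2.2 rfl
      · exact (hT _ h).2.2.2 rfl)
    {v | l v < j} c₀
    (by
      intro v hv
      simp only [Set.mem_ofPred_eq, not_lt] at hv
      by_cases hvp : v = p
      · subst hvp
        obtain ⟨t, ht, htu⟩ := hN v
        refine ⟨t, ht, ?_⟩
        have hcontra : ∀ u, u ≠ v → l u = l v → ¬ (l u < j ∨ f u ≤ f v) := by
          rintro u huv hlu (h | h)
          · omega
          · by_cases h2 : u ∈ T
            · have := hfT u h2; omega
            · have := hfo u huv h2; omega
        rintro u (h | h | ⟨-, h⟩ | ⟨rfl, h⟩) hu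
        · exact (htu u).2 h
        · exact absurd hu (hcontra u h.1.symm h.2.1.symm)
        · exact absurd hu (hcontra u (hT u h).2.2.2 (hT u h).1)
        · exact absurd rfl (hT _ h).2.2.2
      by_cases hvT : v ∈ T
      · have hsame : ∀ u, l u = l v → (l u < j ∨ f u ≤ f v) → u = p ∨ u ∈ T := by
          rintro u hlu (h | h)
          · omega
          · by_contra hcon
            push Not at hcon
            have := hfo u hcon.1 hcon.2
            have := hfT v hvT
            omega
        rcases hT' v hvT with h1 | ⟨x, s, hx, hs⟩
        · obtain ⟨t, ht, htu⟩ := hNup v (hT v hvT).2.2.1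
          refine ⟨insert p t, (Finset.card_insert_le _ _).trans (by omega), ?_⟩
          rintro u (h | h | ⟨rfl, h⟩ | ⟨rfl, h⟩) hu
          · exact Finset.mem_insert_of_mem (htu u h (hle u v hv hu))
          · exact absurd (h1 u (Or.inr h)) h.1.symm
          · exact absurd rfl hvp
          · exact Finset.mem_insert_self _ _
        · refine ⟨{x, p, s}, Finset.card_le_three, ?_⟩
          intro u hH hu
          have huv : u ≠ v := by
            rintro rfl
            rcases hH with h | h | ⟨rfl, h⟩ | ⟨rfl, h⟩
            · exact h.ne rfl
            · exact h.1 rfl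
            · exact hvp rfl
            · exact hvp rfl
          have hlu := hle u v hv hu
          simp only [Finset.mem_insert, Finset.mem_singleton]
          rcases hH with h | h | ⟨rfl, h⟩ | ⟨rfl, h⟩
          · by_cases hluv : l u = l v
            · rcases hsame u hluv hu with h2 | h2
              · exact Or.inr (Or.inl h2)
              · exact Or.inr (Or.inr ((hs u (Or.inl h2)).resolve_left huv))
            · have := hl.adj_le _ _ h
              exact Or.inl (hx u h (by omega))
          · exact Or.inr (Or.inr ((hs u (Or.inr h)).resolve_left huv))
          · exact absurd rfl hvp
          · exact Or.inr (Or.inl rfl)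
      · by_cases hup : HasUpper G l v
        · obtain ⟨t, ht, htu⟩ := hNup v hup
          by_cases hsib : ∃ s, Sibling G l v s
          · obtain ⟨s, hs⟩ := hsib
            refine ⟨insert s t, (Finset.card_insert_le _ _).trans (by omega), ?_⟩
            rintro u (h | h | ⟨rfl, h⟩ | ⟨rfl, h⟩) hu
            · exact Finset.mem_insert_of_mem (htu u h (hle u v hv hu))
            · rw [Sibling.unique hl hdeg (by omega) h hs]
              exact Finset.mem_insert_self _ _
            · exact absurd rfl hvp
            · exact absurd h hvT
          · refine ⟨t, by omega, ?_⟩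
            rintro u (h | h | ⟨rfl, h⟩ | ⟨rfl, h⟩) hu
            · exact htu u h (hle u v hv hu)
            · exact absurd ⟨u, h⟩ hsib
            · exact absurd rfl hvp
            · exact absurd h hvT
        · obtain ⟨t, ht, htu⟩ := hN v
          refine ⟨t, ht, ?_⟩
          rintro u (h | h | ⟨rfl, h⟩ | ⟨rfl, h⟩) hu
          · exact (htu u).2 h
          · exact absurd h.2.2.2.1 hup
          · exact absurd rfl hvp
          · exact absurd h hvT)
  simp only [Set.mem_ofPred_eq, not_lt] at hcB hcH hc3
  refine ⟨c, hcB, ?_, ?_, ?_, ?_⟩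
  · intro u v huv
    by_cases hv : j ≤ l v
    · exact hcH u v (Or.inl huv) hv
    by_cases hu : j ≤ l u
    · exact (hcH v u (Or.inl huv.symm) hu).symm
    rw [hcB u (by omega), hcB v (by omega)]
    exact hc₀ u v huv
  · intro u v hu huv
    exact hcH u v (Or.inr (Or.inl huv)) (by have := huv.2.1; omega)
  · intro t ht
    exact (hcH p t (Or.inr (Or.inr (Or.inl ⟨rfl, ht⟩))) (hT t ht).2.1).symm
  · intro v hv
    by_cases hvT : v ∈ T
    · exact Or.inr hvT
    left
    rcases hc3 v hv with h3 | ⟨u, hH, hu, h3⟩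
    · exact ⟨v, by simp, le_rfl, h3⟩
    refine ⟨u, ?_, hle u v hv hu, h3⟩
    rcases hH with h | h | ⟨rfl, h⟩ | ⟨rfl, h⟩
    · exact (SimpleGraph.dist_le h.toWalk).trans (by simp)
    · obtain ⟨x, hx, hlx⟩ := hl.exists_lower v (by omega)
      have hux := (h.2.2.1 x hlx).1 hx
      exact (SimpleGraph.dist_le (hx.toWalk.append hux.symm.toWalk)).trans (by simp)
    · have h1 := hT u h
      rcases hu with hu | hu
      · omega
      · have := hfT u h
        omega
    · exact absurd h hvT

/-- A non-identity level- and colour-preserving automorphism moves, on one of the levels `n + 1`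
and `n + 2`, a vertex that can be used to break it. -/
theorem exists_breaking_vertex {V : Type*} {G : SimpleGraph V} {l : V → ℕ}
    (hl : IsLevelFunction G l)
    (hdeg : ∀ v, (G.neighborSet v).Finite ∧ (G.neighborSet v).ncard ≤ 3)
    (hmotion : ∀ φ : G ≃g G, (∃ v, φ v ≠ v) → {v | φ v ≠ v}.Infinite)
    {c : V → Fin 4} {m n : ℕ} (hmn : m ≤ n)
    (hc : ∀ u v, m < l v → Sibling G l u v → c u ≠ c v)
    (φ : G ≃g G) (hφ : ∀ v, l (φ v) = l v) (hφc : ∀ v, c (φ v) = c v) (hne : ∃ v, φ v ≠ v) :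
    ∃ p, n < l p ∧ HasUpper G l p ∧ φ p ≠ p ∧ ((∀ u, ¬ Sibling G l p u) ∨
      ∃ x, ∀ y, G.Adj p y → l y + 1 = l p → y = x) := by
  obtain ⟨s, hls, hsu, hs⟩ : ∃ s, l s = n + 2 ∧ HasUpper G l s ∧ φ s ≠ s := by
    by_contra hcon
    push Not at hcon
    have h1 := fixes_of_fixes_level hl hmotion φ hφ (n + 2) hcon
    obtain ⟨v, hv⟩ := hne
    refine hv (agree_of_agree hl hmotion (n := l v) hc (RelIso.refl _) φ (fun _ => rfl) hφ
      (fun _ _ => rfl) (fun v _ => hφc v) (m := m) (fun v hv => ?_) v le_rfl)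
    exact h1 v (by omega)
  by_cases hsib : ∃ t, Sibling G l s t
  swap
  · exact ⟨s, by omega, hsu, hs, Or.inl fun u hu => hsib ⟨u, hu⟩⟩
  obtain ⟨t, hst⟩ := hsib
  obtain ⟨p, hsp, hlp, hp⟩ : ∃ p, G.Adj s p ∧ l p + 1 = l s ∧ φ p ≠ p := by
    by_contra hcon
    push Not at hcon
    rcases eq_or_sibling_of_agree (RelIso.refl _) φ (fun _ => rfl) hφ hsu hcon with h | h
    · exact hs h
    · exact hc _ _ (by rw [hφ]; omega) h (hφc s).symm
  refine ⟨p, by omega, ⟨s, hsp.symm, hlp.symm⟩, hp, Or.inr ?_⟩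
  obtain ⟨x, hx, hlx⟩ := hl.exists_lower p (by omega)
  refine ⟨x, fun y hy hly => ?_⟩
  by_contra hyx
  have htp := (hst.2.2.1 p hlp).1 hsp
  have hlt := hst.2.1
  refine no_four_neighbors hdeg hsp.symm htp.symm hx hy hst.1 ?_ ?_ ?_ ?_ (Ne.symm hyx) <;>
  · rintro rfl
    omega

/-- Partial progress in the construction of a distinguishing colouring: `c` extends `c₀`, is proper
and distinguishes siblings, and every vertex above level `m` is near a vertex of colour `3`, which
for vertices up to level `n` does not depend on the colours above level `n`. -/
structure IsAdmissible {V : Type*} (G : SimpleGraph V) (l : V → ℕ) (m : ℕ) (c₀ : V → Fin 4)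
    (c : V → Fin 4) (n : ℕ) : Prop where
  le : m ≤ n
  eq_of_le : ∀ v, l v ≤ m → c v = c₀ v
  proper : IsProperVertexColoring G c
  sibling : ∀ u v, m < l v → Sibling G l u v → c u ≠ c v
  near_of_le : ∀ v, m < l v → l v ≤ n → ∃ w, G.dist v w ≤ 3 ∧ l w ≤ n ∧ c w = 3
  near_of_lt : ∀ v, n < l v → ∃ w, G.dist v w ≤ 2 ∧ l w ≤ l v ∧ c w = 3

/-- The restrictions to the levels at most `m` of the level-preserving automorphisms that preserve
`c` up to level `n`. -/
def partialAutomorphisms {V : Type*} (G : SimpleGraph V) (l : V → ℕ) (m : ℕ) (c : V → Fin 4)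
    (n : ℕ) : Set ({v // l v ≤ m} → {v // l v ≤ m}) :=
  {g | ∃ φ : G ≃g G, (∀ v, l (φ v) = l v) ∧ (∀ v, l v ≤ n → c (φ v) = c v) ∧ ∀ x, (g x : V) = φ x}

/-- A non-identity automorphism preserving an admissible colouring can be broken. -/
theorem IsAdmissible.exists_ncard_lt {V : Type*} {G : SimpleGraph V} {l : V → ℕ}
    (hG : G.Connected) (hl : IsLevelFunction G l)
    (hdeg : ∀ v, (G.neighborSet v).Finite ∧ (G.neighborSet v).ncard ≤ 3)
    (hmotion : ∀ φ : G ≃g G, (∃ v, φ v ≠ v) → {v | φ v ≠ v}.Infinite)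
    {m : ℕ} (hm : 1 ≤ m) {c₀ c : V → Fin 4} {n : ℕ} (h : IsAdmissible G l m c₀ c n)
    (φ : G ≃g G) (hφ : ∀ v, l (φ v) = l v) (hφc : ∀ v, c (φ v) = c v) (hne : ∃ v, φ v ≠ v) :
    ∃ c' n', IsAdmissible G l m c₀ c' n' ∧
      (partialAutomorphisms G l m c' n').ncard < (partialAutomorphisms G l m c n).ncard := by
  obtain ⟨p, hnp, hup, hp, hcase⟩ :=
    exists_breaking_vertex hl hdeg hmotion h.le h.sibling φ hφ hφc hne
  have hmn := h.le
  have hφs : ∀ v, l (φ.symm v) = l v := fun v => by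
    conv_rhs => rw [← φ.apply_symm_apply v, hφ]
  have hnsib : ¬ Sibling G l (φ p) p := fun hs => h.sibling _ _ (by omega) hs (hφc p)
  obtain ⟨c', hc'lt, hc'p, hc's, hc'T, hc'n⟩ := exists_recoloring hl hdeg c h.proper (l p)
    (by omega) p {t | t = φ p ∨ Sibling G l (φ p) t}
    (by
      rintro t (rfl | ht)
      · exact ⟨hφ p, (hφ p).ge, hup.map φ hφ, hp⟩
      · have h1 : l t = l p := by rw [← ht.2.1, hφ]
        refine ⟨h1, h1.ge, ht.2.2.2.2, ?_⟩
        rintro rfl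
        exact hnsib ht)
    (by
      have hlow : ∀ t, (t = φ p ∨ Sibling G l (φ p) t) → ∀ y, G.Adj t y → l y + 1 = l t →
          G.Adj p (φ.symm y) ∧ l (φ.symm y) + 1 = l p := by
        intro t ht y hy hly
        have h1 : l t = l p := by
          rcases ht with rfl | ht
          · exact hφ p
          · rw [← ht.2.1, hφ]
        have h2 : G.Adj (φ p) y := by
          rcases ht with rfl | ht
          · exact hy
          · exact (ht.2.2.1 y (by rw [hφ]; omega)).2 hy
        rw [hφs]
        refine ⟨?_, by omega⟩
        rw [← φ.map_adj_iff, φ.apply_symm_apply]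
        exact h2
      rcases hcase with hno | ⟨x, hx⟩
      · have hno' : ∀ u, ¬ Sibling G l (φ p) u := by
          intro u hu
          refine hno (φ.symm u) ⟨?_, ?_, ?_, hup, hu.2.2.2.2.map φ.symm hφs⟩
          · rintro heq
            apply hu.1
            rw [heq, φ.apply_symm_apply]
          · rw [hφs, ← hu.2.1, hφ]
          · intro y hy
            have := hu.2.2.1 (φ y) (by rw [hφ, hφ]; exact hy)
            rw [φ.map_adj_iff] at this
            rw [this, ← φ.map_adj_iff (v := φ.symm u), φ.apply_symm_apply]
        rintro t (rfl | ht)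
        · left
          rintro u ((hu | hu) | hu)
          · exact hu
          · exact absurd hu (hno' u)
          · exact absurd hu (hno' u)
        · exact absurd ht (hno' t)
      · rintro t ht
        right
        have hxy : ∀ y, G.Adj t y → l y + 1 = l t → y = φ x := by
          intro y hy hly
          obtain ⟨h1, h2⟩ := hlow t ht y hy hly
          rw [← hx _ h1 h2, φ.apply_symm_apply]
        have h2 : 2 ≤ l (φ p) := by rw [hφ]; omega
        rcases ht with rfl | ht
        · by_cases hs : ∃ s, Sibling G l (φ p) s
          · obtain ⟨s, hs⟩ := hs
            refine ⟨φ x, s, hxy, ?_⟩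
            rintro u ((hu | hu) | hu)
            · exact Or.inl hu
            · exact Or.inr (Sibling.unique hl hdeg h2 hu hs)
            · exact Or.inr (Sibling.unique hl hdeg h2 hu hs)
          · refine ⟨φ x, φ p, hxy, ?_⟩
            rintro u ((hu | hu) | hu)
            · exact Or.inl hu
            · exact absurd ⟨u, hu⟩ hs
            · exact absurd ⟨u, hu⟩ hs
        · refine ⟨φ x, φ p, hxy, ?_⟩
          rintro u ((hu | hu) | hu)
          · exact Or.inr hu
          · exact Or.inl (Sibling.unique hl hdeg h2 hu ht)
          · exact Or.inr (Sibling.unique hl hdeg (by rw [← ht.2.1]; exact h2) hu ht.symm))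
  have hfin : Finite {v // l v ≤ m} := (hl.finite_le m).to_subtype
  refine ⟨c', l p + 1, ⟨by omega, ?_, hc'p, ?_, ?_, ?_⟩, ?_⟩
  · intro v hv
    rw [hc'lt v (by omega), h.eq_of_le v hv]
  · intro u v hv hs
    have huv := hs.2.1
    by_cases hlv : l p ≤ l v
    · exact hc's u v (by omega) hs
    · rw [hc'lt u (by omega), hc'lt v (by omega)]
      exact h.sibling u v hv hs
  · intro v hmv hv
    by_cases hvn : l v ≤ n
    · obtain ⟨w, h1, h2, h3⟩ := h.near_of_le v hmv hvn
      exact ⟨w, h1, by omega, by rw [hc'lt w (by omega), h3]⟩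
    by_cases hvp : l v < l p
    · obtain ⟨w, h1, h2, h3⟩ := h.near_of_lt v (by omega)
      exact ⟨w, by omega, by omega, by rw [hc'lt w (by omega), h3]⟩
    rcases hc'n v (by omega) with ⟨w, h1, h2, h3⟩ | hT
    · exact ⟨w, by omega, by omega, h3⟩
    · have hTl : l v = l p ∧ HasUpper G l v := by
        rcases hT with rfl | hT
        · exact ⟨hφ p, hup.map φ hφ⟩
        · exact ⟨by rw [← hT.2.1, hφ], hT.2.2.2.2⟩
      obtain ⟨hlv, u, hu, hlu⟩ := hTl
      rcases hc'n u (by omega) with ⟨w, h1, h2, h3⟩ | hT'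
      · refine ⟨w, ?_, by omega, h3⟩
        have h4 := hG.dist_triangle (u := v) (v := u) (w := w)
        have h5 := SimpleGraph.dist_eq_one_iff_adj.2 hu
        omega
      · exfalso
        rcases hT' with rfl | hT'
        · rw [hφ] at hlu
          omega
        · have := hT'.2.1
          rw [hφ] at this
          omega
  · intro v hv
    rcases hc'n v (by omega) with h1 | hT
    · exact h1
    · exfalso
      rcases hT with rfl | hT
      · rw [hφ] at hv
        omega
      · have := hT.2.1
        rw [hφ] at this
        omega
  · refine Set.ncard_lt_ncard ?_ (Set.toFinite _)
    rw [Set.ssubset_iff_of_subset]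
    · refine ⟨fun x => ⟨φ x, by rw [hφ]; exact x.2⟩, ⟨φ, hφ, fun v _ => hφc v, fun x => rfl⟩, ?_⟩
      rintro ⟨ψ, hψ, hψc, hψφ⟩
      have hψc' : ∀ v, l v ≤ l p - 1 → c (ψ v) = c v := by
        intro v hv
        have := hψ v
        rw [← hc'lt v (by omega), ← hc'lt (ψ v) (by omega)]
        exact hψc v (by omega)
      have hagree := agree_of_agree hl hmotion h.sibling φ ψ hφ hψ (fun v _ => hφc v) hψc'
        (fun v hv => (hψφ ⟨v, hv⟩).symm)
      have hT := eq_or_sibling_of_agree φ ψ hφ hψ hup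
        (fun x _ hx => hagree x (by omega))
      exact hc'T (ψ p) hT (hψc p (by omega))
    · rintro g ⟨ψ, hψ, hψc, hψg⟩
      refine ⟨ψ, hψ, fun v hv => ?_, hψg⟩
      have := hψ v
      rw [← hc'lt v (by omega), ← hc'lt (ψ v) (by omega)]
      exact hψc v (by omega)

/-- A proper colouring all of whose admissible extensions force automorphisms to preserve levels
can be turned into a distinguishing one. -/
theorem exists_distinguishing_of_levelFunction {V : Type*} {G : SimpleGraph V} {l : V → ℕ}
    (hG : G.Connected) (hl : IsLevelFunction G l)
    (hdeg : ∀ v, (G.neighborSet v).Finite ∧ (G.neighborSet v).ncard ≤ 3)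
    (hmotion : ∀ φ : G ≃g G, (∃ v, φ v ≠ v) → {v | φ v ≠ v}.Infinite)
    {m : ℕ} (hm : 1 ≤ m) (c₀ : V → Fin 4) (hc₀ : IsProperVertexColoring G c₀)
    (hkey : ∀ c : V → Fin 4, (∀ v, l v ≤ m → c v = c₀ v) →
      (∀ v, m < l v → ∃ w, G.dist v w ≤ 3 ∧ c w = 3) →
      ∀ φ : G ≃g G, (∀ v, c (φ v) = c v) → ∀ v, l (φ v) = l v) :
    ∃ c : V → Fin 4, IsProperVertexColoring G c ∧ IsDistinguishingVertexColoring G c := by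
  have main : ∀ N c n, IsAdmissible G l m c₀ c n → (partialAutomorphisms G l m c n).ncard = N →
      ∃ c : V → Fin 4, IsProperVertexColoring G c ∧ IsDistinguishingVertexColoring G c := by
    intro N
    induction N using Nat.strong_induction_on with
    | _ N ih =>
      intro c n hc hN
      by_cases hD : IsDistinguishingVertexColoring G c
      · exact ⟨c, hc.proper, hD⟩
      unfold IsDistinguishingVertexColoring at hD
      push Not at hD
      obtain ⟨φ, hφc, hne⟩ := hD
      have hφ : ∀ v, l (φ v) = l v := by
        refine hkey c hc.eq_of_le (fun v hv => ?_) φ hφc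
        by_cases hvn : l v ≤ n
        · obtain ⟨w, h1, -, h3⟩ := hc.near_of_le v hv hvn
          exact ⟨w, h1, h3⟩
        · obtain ⟨w, h1, -, h3⟩ := hc.near_of_lt v (by omega)
          exact ⟨w, by omega, h3⟩
      obtain ⟨c', n', hc', hlt⟩ := hc.exists_ncard_lt hG hl hdeg hmotion hm φ hφ hφc hne
      exact ih _ (hN ▸ hlt) c' n' hc' rfl
  obtain ⟨p⟩ := hG.nonempty
  obtain ⟨c, hlt, hcp, hcs, -, hc3⟩ := exists_recoloring hl hdeg c₀ hc₀ (m + 1) (by omega) p ∅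
    (by simp) (by simp)
  refine main _ c m ⟨le_rfl, fun v hv => hlt v (by omega), hcp, fun u v hv hs => ?_, ?_, ?_⟩ rfl
  · exact hcs u v (by rw [hs.2.1]; omega) hs
  · intro v h1 h2
    omega
  · intro v hv
    simpa using hc3 v hv

/-- In a connected graph, every vertex `v ≠ u` has a neighbour closer to `u`. -/
theorem exists_adj_dist_add_one {V : Type*} {G : SimpleGraph V} (hG : G.Connected) {u v : V}
    (h : u ≠ v) : ∃ w, G.Adj v w ∧ G.dist u w + 1 = G.dist u v := by
  obtain ⟨p, hp⟩ := hG.exists_walk_length_eq_dist v u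
  cases p with
  | nil => exact absurd rfl h
  | cons hadj q =>
    rename_i w
    refine ⟨w, hadj, ?_⟩
    have h1 := SimpleGraph.dist_le q
    have h2 := hG.dist_triangle (u := v) (v := w) (w := u)
    have h3 := SimpleGraph.dist_eq_one_iff_adj.2 hadj
    rw [SimpleGraph.Walk.length_cons] at hp
    rw [G.dist_comm (u := u) (v := w), G.dist_comm (u := u) (v := v)]
    omega

/-- Balls in connected locally finite graphs are finite. -/
theorem finite_setOf_dist_le {V : Type*} {G : SimpleGraph V} (hG : G.Connected)
    (hfin : ∀ v, (G.neighborSet v).Finite) (r : V) (n : ℕ) : {v | G.dist r v ≤ n}.Finite := by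
  induction n with
  | zero =>
    refine (Set.finite_singleton r).subset fun v hv => ?_
    have hv' : G.dist r v ≤ 0 := hv
    exact (hG.dist_eq_zero_iff.1 (Nat.le_zero.1 hv')).symm
  | succ n ih =>
    refine ((ih.biUnion fun v _ => hfin v).union (Set.finite_singleton r)).subset fun v hv => ?_
    have hv' : G.dist r v ≤ n + 1 := hv
    by_cases hrv : r = v
    · exact Or.inr hrv.symm
    · obtain ⟨w, hw, hd⟩ := exists_adj_dist_add_one hG hrv
      refine Or.inl (Set.mem_biUnion (x := w) ?_ hw.symm)
      change G.dist r w ≤ n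
      omega

/-- The distance from a finite nonempty set is a level function. -/
theorem exists_levelFunction {V : Type*} {G : SimpleGraph V} (hG : G.Connected)
    (hfin : ∀ v, (G.neighborSet v).Finite) (Z : Set V) (hZ : Z.Finite) (hne : Z.Nonempty) :
    ∃ l : V → ℕ, IsLevelFunction G l ∧ (∀ v, ∃ z ∈ Z, G.dist z v = l v) ∧
      ∀ v, ∀ z ∈ Z, l v ≤ G.dist z v := by
  let l : V → ℕ := fun v => sInf (Set.image (fun z => G.dist z v) Z)
  have h1 : ∀ v, ∃ z ∈ Z, G.dist z v = l v := fun v => Nat.sInf_mem (hne.image _)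
  have h2 : ∀ v, ∀ z ∈ Z, l v ≤ G.dist z v := fun v z hz =>
    Nat.sInf_le (Set.mem_image_of_mem _ hz)
  refine ⟨l, ⟨?_, ?_, ?_⟩, h1, h2⟩
  · intro u v huv
    obtain ⟨z, hz, hzv⟩ := h1 v
    have h3 := h2 u z hz
    have h4 := hG.dist_triangle (u := z) (v := v) (w := u)
    have h5 := SimpleGraph.dist_eq_one_iff_adj.2 huv.symm
    omega
  · intro v hv
    obtain ⟨z, hz, hzv⟩ := h1 v
    have hne : z ≠ v := by
      rintro rfl
      rw [SimpleGraph.dist_self] at hzv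
      omega
    obtain ⟨w, hw, hd⟩ := exists_adj_dist_add_one hG hne
    refine ⟨w, hw, ?_⟩
    have h3 := h2 w z hz
    obtain ⟨z', hz', hzw⟩ := h1 w
    have h4 := h2 v z' hz'
    have h5 := hG.dist_triangle (u := z') (v := w) (w := v)
    have h6 := SimpleGraph.dist_eq_one_iff_adj.2 hw.symm
    omega
  · intro n
    refine (hZ.biUnion fun z _ => finite_setOf_dist_le hG hfin z n).subset fun v hv => ?_
    obtain ⟨z, hz, hzv⟩ := h1 v
    refine Set.mem_biUnion hz ?_
    change G.dist z v ≤ n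
    rw [hzv]
    exact hv

/-- A finite set `D` of vertices of an infinite connected subcubic graph can be coloured without
using the colour `3` in a proper colouring in which the closed neighbourhood of every vertex
outside `D` contains a vertex of colour `3`. -/
theorem exists_coloring_avoiding {V : Type*} [Infinite V] {G : SimpleGraph V} (hG : G.Connected)
    (hdeg : ∀ v, (G.neighborSet v).Finite ∧ (G.neighborSet v).ncard ≤ 3) (D : Set V)
    (hD : D.Finite) :
    ∃ c : V → Fin 4, IsProperVertexColoring G c ∧ (∀ v ∈ D, c v ≠ 3) ∧
      ∀ v, v ∉ D → ∃ w, G.dist v w ≤ 1 ∧ c w = 3 := by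
  classical
  obtain ⟨o, ho⟩ := hD.exists_notMem
  obtain ⟨N, hN⟩ := (hD.image (fun v => G.dist o v)).bddAbove
  have hN' : ∀ v ∈ D, G.dist o v ≤ N := fun v hv => hN (Set.mem_image_of_mem _ hv)
  have hcard : ∀ v, (hdeg v).1.toFinset.card ≤ 3 := fun v => by
    rw [← Set.ncard_eq_toFinset_card _ (hdeg v).1]
    exact (hdeg v).2
  obtain ⟨d, -, hd, -⟩ := exists_greedy_coloring (k := 2) (fun v => N - G.dist o v)
    (fun u v => G.Adj u v ∧ u ∈ D ∧ v ∈ D) (fun u v h => ⟨h.1.symm, h.2.2, h.2.1⟩)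
    (fun v h => h.1.ne rfl) Dᶜ (fun _ => 0)
    (by
      intro v hv
      have hvD : v ∈ D := by simpa using hv
      obtain ⟨w, hw, hdw⟩ := exists_adj_dist_add_one hG (u := o) (v := v)
        (by rintro rfl; exact ho hvD)
      refine ⟨(hdeg v).1.toFinset.erase w, ?_, ?_⟩
      · rw [Finset.card_erase_of_mem (by simpa using hw)]
        have := hcard v
        omega
      · rintro u ⟨hu, -, huD⟩ hle
        refine Finset.mem_erase.2 ⟨?_, by simpa using hu⟩
        rintro rfl
        rcases hle with h | h
        · exact h huD
        · have h1 := hN' v hvD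
          have h2 := hN' u huD
          omega)
  obtain ⟨c, hcD, hc, hc3⟩ := exists_greedy_coloring (k := 3) (fun _ => 0) G.Adj
    (fun u v h => h.symm) (fun v h => h.ne rfl) D (fun v => (d v).castSucc)
    (fun v _ => ⟨(hdeg v).1.toFinset, hcard v, fun u hu _ => by simpa using hu⟩)
  refine ⟨c, ?_, ?_, ?_⟩
  · intro u v huv
    by_cases hv : v ∈ D
    · by_cases hu : u ∈ D
      · rw [hcD u hu, hcD v hv]
        intro heq
        exact hd u v ⟨huv, hu, hv⟩ (by simpa using hv) (Fin.castSucc_injective _ heq)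
      · exact (hc v u huv.symm hu).symm
    · exact hc u v huv hv
  · intro v hv
    rw [hcD v hv]
    exact (Fin.castSucc_lt_last (d v)).ne
  · intro v hv
    rcases hc3 v hv with h | ⟨u, hu, -, h⟩
    · exact ⟨v, by simp, h⟩
    · exact ⟨u, (SimpleGraph.dist_eq_one_iff_adj.2 hu).le, h⟩

/-- Graph automorphisms of a connected graph preserve distances. -/
theorem dist_map_iso {V : Type*} {G : SimpleGraph V} (hG : G.Connected) (φ : G ≃g G) (u v : V) :
    G.dist (φ u) (φ v) = G.dist u v := by
  have key : ∀ (ψ : G ≃g G) a b, G.dist (ψ a) (ψ b) ≤ G.dist a b := by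
    intro ψ a b
    obtain ⟨p, hp⟩ := hG.exists_walk_length_eq_dist a b
    rw [← hp, ← SimpleGraph.Walk.length_map ψ.toHom p]
    exact SimpleGraph.dist_le _
  refine le_antisymm (key φ u v) ?_
  simpa using key φ.symm (φ u) (φ v)

/-- A connected subcubic graph with infinite motion admits a proper distinguishing
vertex colouring with 4 colours; i.e. `χ_D(G) ≤ 4`. -/
theorem subcubic_infinite_motion_distinguishingChromaticNumber_le_four
    {V : Type*} (G : SimpleGraph V) (hG : G.Connected)
    (hdeg : ∀ v, (G.neighborSet v).Finite ∧ (G.neighborSet v).ncard ≤ 3)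
    (hmotion : ∀ φ : G ≃g G, (∃ v, φ v ≠ v) → {v | φ v ≠ v}.Infinite) :
    ∃ c : V → Fin 4,
      IsProperVertexColoring G c ∧ IsDistinguishingVertexColoring G c := by
  classical
  rcases finite_or_infinite V with hfin | hinf
  · obtain ⟨c, -, hc, -⟩ := exists_greedy_coloring (k := 3) (fun _ => 0) G.Adj
      (fun u v h => h.symm) (fun v h => h.ne rfl) ∅ (fun _ => 0)
      (fun v _ => ⟨(hdeg v).1.toFinset, by
        rw [← Set.ncard_eq_toFinset_card _ (hdeg v).1]
        exact (hdeg v).2, fun u hu _ => by simpa using hu⟩)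
    refine ⟨c, fun u v huv => hc u v huv (Set.notMem_empty v), fun φ _ v => ?_⟩
    by_contra hne
    exact hmotion φ ⟨v, hne⟩ (Set.toFinite _)
  obtain ⟨r⟩ := hG.nonempty
  obtain ⟨c₀, hc₀, hc₀D, hc₀3⟩ := exists_coloring_avoiding hG hdeg {v | G.dist r v ≤ 4}
    (finite_setOf_dist_le hG (fun v => (hdeg v).1) r 4)
  let Z : (V → Fin 4) → Set V := fun c => {y | ∀ w, G.dist y w ≤ 4 → c w ≠ 3}
  have hrZ : r ∈ Z c₀ := hc₀D
  have hZD : ∀ y ∈ Z c₀, G.dist r y ≤ 4 := by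
    intro y hy
    by_contra hcon
    obtain ⟨w, hw, h3⟩ := hc₀3 y hcon
    exact hy w (by omega) h3
  obtain ⟨l, hl, hlex, hlle⟩ := exists_levelFunction hG (fun v => (hdeg v).1) (Z c₀)
    ((finite_setOf_dist_le hG (fun v => (hdeg v).1) r 4).subset hZD) ⟨r, hrZ⟩
  have hldist : ∀ u v, l u ≤ l v + G.dist v u := by
    intro u v
    obtain ⟨z, hz, hzv⟩ := hlex v
    have h1 := hlle u z hz
    have h2 := hG.dist_triangle (u := z) (v := v) (w := u)
    omega
  refine exists_distinguishing_of_levelFunction hG hl hdeg hmotion (m := 8) (by norm_num) c₀ hc₀ ?_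
  intro c hcc₀ hc3 φ hφc
  have hZc : Z c = Z c₀ := by
    ext y
    by_cases hy : l y ≤ 4
    · refine forall₂_congr fun w hw => ?_
      have := hldist w y
      rw [hcc₀ w (by omega)]
    · have h1 : y ∉ Z c₀ := by
        intro h
        have h2 := hlle y y h
        rw [SimpleGraph.dist_self] at h2
        omega
      refine iff_of_false (fun h => ?_) h1
      obtain ⟨w, hw, h3⟩ := hc₀3 y (fun h2 => hy ((hlle y r hrZ).trans h2))
      by_cases hlw : l w ≤ 8
      · exact h w (by omega) (by rw [hcc₀ w hlw, h3])
      · obtain ⟨x, hx, hx3⟩ := hc3 w (by omega)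
        have h4 := hG.dist_triangle (u := y) (v := w) (w := x)
        exact h x (by omega) hx3
  have hle : ∀ ψ : G ≃g G, (∀ v, c (ψ v) = c v) → ∀ v, l (ψ v) ≤ l v := by
    intro ψ hψ v
    obtain ⟨z, hz, hzv⟩ := hlex v
    rw [← hzv, ← dist_map_iso hG ψ z v]
    refine hlle _ _ ?_
    rw [← hZc] at hz ⊢
    intro w hw
    obtain ⟨x, rfl⟩ := ψ.surjective w
    rw [dist_map_iso hG] at hw
    rw [hψ]
    exact hz x hw
  intro v
  refine le_antisymm (hle φ hφc v) ?_
  simpa using hle φ.symm (fun v => by rw [← hφc, φ.apply_symm_apply]) (φ v)
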